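/- Let 𝒜 = (I, (A_a)_{a∈Σ}, F) be a minimal uniformly convergent WFA. Then for all row vectors I' and column vectors F', the WFA ℬ = (I', (A_a)_{a∈Σ}, F') is also uniformly convergent (and hence f_ℬ is defined everywhere and continuous on Σ^ω). -/

import Mathlib

open Filter Topology Matrix

/-- The prefix of length `k` of an infinite word `w`. -/
def pref {A : Type*} (w : ℕ → A) (k : ℕ) : List A := (List.range k).map w

/-- The product `A_{v₁} ⋯ A_{v_k}` of matrices along a finite word `v`. -/
def wordProd {A : Type*} {n : ℕ} (M : A → Matrix (Fin n) (Fin n) ℝ) (v : List A) :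
    Matrix (Fin n) (Fin n) ℝ := (v.map M).prod

/-- The word function of the WFA `(I, M, F)`: `v ↦ I A_v F`. -/
def wfaWord {A : Type*} {n : ℕ} (I : Fin n → ℝ) (M : A → Matrix (Fin n) (Fin n) ℝ)
    (F : Fin n → ℝ) (v : List A) : ℝ := I ⬝ᵥ (wordProd M v) *ᵥ F

/-- The WFA with `n` states is left minimal: the row vectors `I A_u` span `ℝⁿ`. -/
def LeftMinimal {A : Type*} {n : ℕ} (I : Fin n → ℝ)
    (M : A → Matrix (Fin n) (Fin n) ℝ) : Prop :=
  Submodule.span ℝ {x : Fin n → ℝ | ∃ u : List A, x = I ᵥ* (wordProd M u)} = ⊤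

/-- The WFA with `n` states is right minimal: the column vectors `A_u F` span `ℝⁿ`. -/
def RightMinimal {A : Type*} {n : ℕ} (M : A → Matrix (Fin n) (Fin n) ℝ)
    (F : Fin n → ℝ) : Prop :=
  Submodule.span ℝ {x : Fin n → ℝ | ∃ u : List A, x = (wordProd M u) *ᵥ F} = ⊤

/-- A word function `F : Σ* → ℝ` is uniformly convergent with ω-function `f`. -/
def UnifConv {A : Type*} (F : List A → ℝ) (f : (ℕ → A) → ℝ) : Prop :=
  (∀ w : ℕ → A, Tendsto (fun k => F (pref w k)) atTop (𝓝 (f w))) ∧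
  ∀ ε > (0 : ℝ), ∃ k₀ : ℕ, ∀ w : ℕ → A, ∀ k > k₀, |F (pref w k) - f w| < ε

/-- A word function is uniformly Cauchy if extending a sufficiently long word changes its value
arbitrarily little. -/
def UnifCauchyWord {A : Type*} (F : List A → ℝ) : Prop :=
  ∀ ε > (0 : ℝ), ∃ k₀ : ℕ, ∀ x y : List A, k₀ < x.length → |F (x ++ y) - F x| < ε

theorem length_pref {A : Type*} (w : ℕ → A) (k : ℕ) : (pref w k).length = k := by
  simp [pref]

theorem pref_append_exists {A : Type*} (w : ℕ → A) (k l : ℕ) :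
    ∃ y, pref w (k + l) = pref w k ++ y :=
  ⟨_, by rw [pref, List.range_add, List.map_append]; rfl⟩

theorem pref_congr {A : Type*} {w w' : ℕ → A} {k : ℕ} (h : ∀ i < k, w i = w' i) :
    pref w k = pref w' k :=
  List.map_congr_left fun i hi => h i (List.mem_range.1 hi)

theorem pref_getD_append {A : Type*} (x y : List A) (a : A) :
    pref (fun i => (x ++ y).getD i a) x.length = x := by
  apply List.ext_getElem
  · simp [pref]
  · intro i h₁ h₂
    simp [pref, List.getElem?_append_left h₂, h₂]

theorem UnifConv.unifCauchyWord {A : Type*} [Nonempty A] {F : List A → ℝ} {f : (ℕ → A) → ℝ}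
    (h : UnifConv F f) : UnifCauchyWord F := by
  intro ε hε
  obtain ⟨k₀, hk⟩ := h.2 (ε / 2) (half_pos hε)
  refine ⟨k₀, fun x y hx => ?_⟩
  let a : A := Classical.arbitrary A
  have h₁ := hk (fun i => (x ++ y).getD i a) x.length hx
  have h₂ := hk (fun i => (x ++ y).getD i a) (x ++ y).length (by simp; omega)
  rw [pref_getD_append] at h₁
  have h₃ := pref_getD_append (x ++ y) [] a
  rw [List.append_nil] at h₃
  rw [h₃] at h₂
  rw [abs_lt] at *
  constructor <;> linarith

namespace UnifCauchyWord

variable {A : Type*} {F G : List A → ℝ}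

theorem zero : UnifCauchyWord (fun _ : List A => (0 : ℝ)) :=
  fun ε hε => ⟨0, fun _ _ _ => by simpa using hε⟩

theorem add (hF : UnifCauchyWord F) (hG : UnifCauchyWord G) :
    UnifCauchyWord (fun v => F v + G v) := by
  intro ε hε
  obtain ⟨k, hk⟩ := hF (ε / 2) (half_pos hε)
  obtain ⟨l, hl⟩ := hG (ε / 2) (half_pos hε)
  refine ⟨max k l, fun x y hx => ?_⟩
  have h₁ := hk x y (by omega)
  have h₂ := hl x y (by omega)
  rw [abs_lt] at *
  constructor <;> linarith

theorem const_mul (hF : UnifCauchyWord F) (c : ℝ) : UnifCauchyWord (fun v => c * F v) := by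
  intro ε hε
  have hc : 0 < |c| + 1 := by positivity
  obtain ⟨k, hk⟩ := hF (ε / (|c| + 1)) (div_pos hε hc)
  refine ⟨k, fun x y hx => ?_⟩
  have h := hk x y hx
  rw [lt_div_iff₀ hc] at h
  rw [← mul_sub, abs_mul]
  nlinarith [abs_nonneg (F (x ++ y) - F x)]

theorem append_left (hF : UnifCauchyWord F) (u : List A) :
    UnifCauchyWord (fun v => F (u ++ v)) := by
  intro ε hε
  obtain ⟨k, hk⟩ := hF ε hε
  refine ⟨k, fun x y hx => ?_⟩
  simpa using hk (u ++ x) y (by simp; omega)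

theorem append_right (hF : UnifCauchyWord F) (u : List A) :
    UnifCauchyWord (fun v => F (v ++ u)) := by
  intro ε hε
  obtain ⟨k, hk⟩ := hF (ε / 2) (half_pos hε)
  refine ⟨k, fun x y hx => ?_⟩
  have h₁ := hk x (y ++ u) hx
  have h₂ := hk x u hx
  rw [← List.append_assoc] at h₁
  rw [abs_lt] at *
  constructor <;> linarith

theorem exists_unifConv (hF : UnifCauchyWord F) : ∃ f, UnifConv F f := by
  have hlim : ∀ w : ℕ → A, ∃ l, Tendsto (fun k => F (pref w k)) atTop (𝓝 l) := by
    intro w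
    refine cauchySeq_tendsto_of_complete (Metric.cauchySeq_iff'.2 fun ε hε => ?_)
    obtain ⟨k, hk⟩ := hF ε hε
    refine ⟨k + 1, fun m hm => ?_⟩
    obtain ⟨l, rfl⟩ := Nat.exists_eq_add_of_le hm
    obtain ⟨y, hy⟩ := pref_append_exists w (k + 1) l
    rw [Real.dist_eq, hy]
    exact hk _ _ (by rw [length_pref]; omega)
  choose f hf using hlim
  refine ⟨f, hf, fun ε hε => ?_⟩
  obtain ⟨k₀, hk⟩ := hF (ε / 2) (half_pos hε)
  refine ⟨k₀, fun w k hkk => ?_⟩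
  have hle : |f w - F (pref w k)| ≤ ε / 2 := by
    refine le_of_tendsto ((hf w).sub_const (F (pref w k))).abs ?_
    filter_upwards [eventually_ge_atTop k] with m hm
    obtain ⟨l, rfl⟩ := Nat.exists_eq_add_of_le hm
    obtain ⟨y, hy⟩ := pref_append_exists w k l
    rw [hy]
    exact (hk _ _ (by rwa [length_pref])).le
  rw [abs_sub_comm]
  linarith

end UnifCauchyWord

theorem UnifConv.continuous {A : Type*} [TopologicalSpace A] [DiscreteTopology A]
    {F : List A → ℝ} {f : (ℕ → A) → ℝ} (h : UnifConv F f) : Continuous f := by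
  refine continuous_iff_continuousAt.2 fun w => Metric.tendsto_nhds.2 fun ε hε => ?_
  obtain ⟨k, hk⟩ := h.2 (ε / 2) (half_pos hε)
  have hev : ∀ᶠ w' in 𝓝 w, ∀ i ∈ Finset.range (k + 1), w' i = w i := by
    rw [Filter.eventually_all_finset]
    intro i _
    exact (continuous_apply i).continuousAt.eventually_mem
      ((isOpen_discrete {w i}).mem_nhds rfl)
  filter_upwards [hev] with w' hw'
  have h₁ := hk w' (k + 1) (by omega)
  have h₂ := hk w (k + 1) (by omega)
  rw [pref_congr fun i hi => hw' i (Finset.mem_range.2 hi)] at h₁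
  rw [Real.dist_eq]
  rw [abs_lt] at *
  constructor <;> linarith

theorem wordProd_append {A : Type*} {n : ℕ} (M : A → Matrix (Fin n) (Fin n) ℝ) (u v : List A) :
    wordProd M (u ++ v) = wordProd M u * wordProd M v := by
  simp [wordProd]

theorem wfaWord_vecMul_left {A : Type*} {n : ℕ} (I : Fin n → ℝ)
    (M : A → Matrix (Fin n) (Fin n) ℝ) (F : Fin n → ℝ) (u v : List A) :
    wfaWord (I ᵥ* wordProd M u) M F v = wfaWord I M F (u ++ v) := by
  rw [wfaWord, wfaWord, wordProd_append, ← dotProduct_mulVec, mulVec_mulVec]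

theorem wfaWord_mulVec_right {A : Type*} {n : ℕ} (I : Fin n → ℝ)
    (M : A → Matrix (Fin n) (Fin n) ℝ) (F : Fin n → ℝ) (u v : List A) :
    wfaWord I M (wordProd M u *ᵥ F) v = wfaWord I M F (v ++ u) := by
  rw [wfaWord, wfaWord, wordProd_append, mulVec_mulVec]

theorem RightMinimal.unifCauchyWord {A : Type*} {n : ℕ} {I : Fin n → ℝ}
    {M : A → Matrix (Fin n) (Fin n) ℝ} {F : Fin n → ℝ} (hr : RightMinimal M F)
    (h : UnifCauchyWord (wfaWord I M F)) (F' : Fin n → ℝ) :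
    UnifCauchyWord (wfaWord I M F') := by
  have hF' := Submodule.mem_top (R := ℝ) (x := F')
  rw [← show _ = _ from hr] at hF'
  induction hF' using Submodule.span_induction with
  | mem x hx =>
    obtain ⟨u, rfl⟩ := hx
    rw [funext (wfaWord_mulVec_right I M F u)]
    exact h.append_right u
  | zero =>
    convert UnifCauchyWord.zero (A := A) using 2 with v
    simp [wfaWord]
  | add x y _ _ hx hy =>
    convert hx.add hy using 2 with v
    simp [wfaWord, mulVec_add, dotProduct_add]
  | smul c x _ hx =>
    convert hx.const_mul c using 2 with v
    simp [wfaWord, mulVec_smul, dotProduct_smul]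

theorem LeftMinimal.unifCauchyWord {A : Type*} {n : ℕ} {I : Fin n → ℝ}
    {M : A → Matrix (Fin n) (Fin n) ℝ} {F : Fin n → ℝ} (hl : LeftMinimal I M)
    (h : UnifCauchyWord (wfaWord I M F)) (I' : Fin n → ℝ) :
    UnifCauchyWord (wfaWord I' M F) := by
  have hI' := Submodule.mem_top (R := ℝ) (x := I')
  rw [← show _ = _ from hl] at hI'
  induction hI' using Submodule.span_induction with
  | mem x hx =>
    obtain ⟨u, rfl⟩ := hx
    rw [funext (wfaWord_vecMul_left I M F u)]
    exact h.append_left u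
  | zero =>
    convert UnifCauchyWord.zero (A := A) using 2 with v
    simp [wfaWord]
  | add x y _ _ hx hy =>
    convert hx.add hy using 2 with v
    simp [wfaWord, add_dotProduct]
  | smul c x _ hx =>
    convert hx.const_mul c using 2 with v
    simp [wfaWord, smul_dotProduct]

/-- Let `𝒜 = (I, (A_a), F)` be a minimal, uniformly convergent WFA.  Then any WFA
`ℬ = (I', (A_a), F')` obtained from `𝒜` by changing the initial and final distributions
is also uniformly convergent (hence its ω-function is everywhere defined and continuous). -/
theorem keep_continuity
    {A : Type*} [Fintype A] [Nonempty A] [TopologicalSpace A] [DiscreteTopology A]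
    {n : ℕ} (I : Fin n → ℝ) (M : A → Matrix (Fin n) (Fin n) ℝ) (F : Fin n → ℝ)
    (hl : LeftMinimal I M) (hr : RightMinimal M F)
    (f : (ℕ → A) → ℝ) (hA : UnifConv (wfaWord I M F) f) :
    ∀ (I' F' : Fin n → ℝ), ∃ g : (ℕ → A) → ℝ,
      UnifConv (wfaWord I' M F') g ∧ Continuous g := by
  intro I' F'
  obtain ⟨g, hg⟩ :=
    (hl.unifCauchyWord (hr.unifCauchyWord hA.unifCauchyWord F') I').exists_unifConv
  exact ⟨g, hg, hg.continuous⟩
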